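/- Let V be a finite set with n = |V|, c ≥ 2, Ω : V×V → ℝ symmetric with 0 ≤ Ω(x,y) ≤ 1. Let (S^k) ⊂ W be defined by S^{k+1} = exp_{S^k}(θ_k·d(S^k,h_k)) with θ_k ∈ [θ_min, θ_max] ⊂ (0,∞), h_k > 0 with h_k·|⟨R_{S^k}(ΩS^k), Ω·R_{S^k}(ΩS^k)⟩| < ‖R_{S^k}(ΩS^k)‖²_{S^k}, Σ_{k≥0} h_k < ∞, θ_k → θ* > 0, and the Armijo condition J(S^{k+1}) − J(S^k) ≤ c₁·θ_k·⟨grad_g J(S^k), R_{S^k}(d(S^k,h_k))⟩_{S^k} holding for all k with a fixed c₁ ∈ (0,1). Suppose further that there exists K ∈ ℕ such that for all k ≥ K, h_k ≤ C(Ω)·‖grad_g J(S^k)‖²_{S^k}/n, where C(Ω) = 2θ_min·c₁/λ(Ω)² and λ(Ω) = max{|λ_min(Ω)|, |λ_max(Ω)|}. Then the set of limit points of (S^k) is a singleton {S*}, D_KL(S*, S^k) → 0 as k → ∞, and S* ∈ W̄ is an equilibrium of the flow Ṡ = R_S(ΩS), i.e., R_{S*(x)}((ΩS*)(x)) = 0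 for all x ∈ V. -/

import Mathlib

open Finset Filter Topology

noncomputable section

variable {V : Type*} [Fintype V] {c : ℕ}

/-- `(Ω S)(x)_j = ∑_y Ω x y * S y j`. -/
def omApp (Ω : V → V → ℝ) (S : V → Fin c → ℝ) (x : V) (j : Fin c) : ℝ :=
  ∑ y, Ω x y * S y j

/-- Replicator map `R_p u = Diag(p)u − ⟨p,u⟩p`. -/
def repl (p u : Fin c → ℝ) (j : Fin c) : ℝ :=
  p j * u j - (∑ i, p i * u i) * p j

/-- Lifting map `exp_p(v) = (p ⊙ e^v)/⟨p, e^v⟩`. -/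
def liftMap (p v : Fin c → ℝ) (j : Fin c) : ℝ :=
  p j * Real.exp (v j) / (∑ i, p i * Real.exp (v i))

/-- Orthogonal projection `Π₀ u = u − (⟨1,u⟩/c)·1`. -/
def proj0 {c : ℕ} (u : Fin c → ℝ) (j : Fin c) : ℝ :=
  u j - (∑ i, u i) / (c : ℝ)

/-- The potential `J(S) = −½ ∑_x ⟨S(x), (ΩS)(x)⟩`. -/
def Jpot (Ω : V → V → ℝ) (S : V → Fin c → ℝ) : ℝ :=
  -(1 / 2) * ∑ x, ∑ j, S x j * omApp Ω S x j

/-- Fisher–Rao inner product `⟨U,W⟩_S = ∑_{x,j} U_j(x) W_j(x) / S_j(x)`. -/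
def frIP (S U W : V → Fin c → ℝ) : ℝ :=
  ∑ x, ∑ j, U x j * W x j / S x j

/-- Riemannian gradient `grad_g J(S) = −R_S(ΩS)`. -/
def gradJ (Ω : V → V → ℝ) (S : V → Fin c → ℝ) (x : V) (j : Fin c) : ℝ :=
  - repl (S x) (omApp Ω S x) j

/-- The vector field `R_S(ΩS)`. -/
def RSOm (Ω : V → V → ℝ) (S : V → Fin c → ℝ) (x : V) (j : Fin c) : ℝ :=
  repl (S x) (omApp Ω S x) j

/-- Descent direction `d(S,h) = Π₀(ΩS + (h/2)·Ω·R_S(ΩS))`. -/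
def dDir (Ω : V → V → ℝ) (S : V → Fin c → ℝ) (h : ℝ) (x : V) (j : Fin c) : ℝ :=
  proj0 (fun i => omApp Ω S x i + (h / 2) * omApp Ω (RSOm Ω S) x i) j

/-- Kullback–Leibler divergence `D_KL(S*,S) = ∑_{x,j} S*_j(x) log(S*_j(x)/S_j(x))`. -/
def dKL {V : Type*} [Fintype V] {c : ℕ} (Sstar S : V → Fin c → ℝ) : ℝ :=
  ∑ x, ∑ j, Sstar x j * Real.log (Sstar x j / S x j)

theorem Real.exp_sub_one_sub_id_le_sq_mul_exp {t M : ℝ} (ht : |t| ≤ M) :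
    Real.exp t - 1 - t ≤ t ^ 2 * Real.exp M := by
  have h1 : Real.exp t - 1 ≤ t * Real.exp t := by
    have h := Real.add_one_le_exp (-t)
    have h2 : Real.exp (-t) * Real.exp t = 1 := by rw [← Real.exp_add]; simp
    nlinarith [Real.exp_pos t]
  have h0 := Real.add_one_le_exp t
  have hM : 1 ≤ Real.exp M := Real.one_le_exp ((abs_nonneg t).trans ht)
  rcases le_total 0 t with h | h
  · have h3 : Real.exp t ≤ Real.exp M := Real.exp_le_exp.2 ((le_abs_self t).trans ht)
    nlinarith [mul_le_mul_of_nonneg_left h1 h, mul_le_mul_of_nonneg_left h3 (sq_nonneg t)]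
  · nlinarith [mul_le_mul_of_nonneg_left hM (sq_nonneg t),
      mul_nonneg (neg_nonneg.2 h) (sub_nonneg.2 h0)]

theorem sum_mul_exp_pos {ι : Type*} [Fintype ι] {p : ι → ℝ} (hp : ∀ i, 0 < p i)
    (hp1 : ∑ i, p i = 1) (w : ι → ℝ) : 0 < ∑ i, p i * Real.exp (w i) := by
  have : Nonempty ι := by
    by_contra h
    rw [not_nonempty_iff] at h
    simp at hp1
  exact sum_pos (fun i _ => mul_pos (hp i) (Real.exp_pos _)) univ_nonempty

theorem exp_sum_le_sum_mul_exp {ι : Type*} [Fintype ι] {p : ι → ℝ} (hp : ∀ i, 0 < p i)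
    (hp1 : ∑ i, p i = 1) (w : ι → ℝ) :
    Real.exp (∑ i, p i * w i) ≤ ∑ i, p i * Real.exp (w i) := by
  simpa using convexOn_exp.map_sum_le (t := univ) (w := p) (p := w)
    (fun i _ => (hp i).le) hp1 (fun i _ => Set.mem_univ _)

theorem log_sum_mul_exp_le {ι : Type*} [Fintype ι] {p : ι → ℝ} (hp : ∀ i, 0 < p i)
    (hp1 : ∑ i, p i = 1) {w : ι → ℝ} {M : ℝ} (hM : ∀ i, |w i - ∑ l, p l * w l| ≤ M) :
    Real.log (∑ i, p i * Real.exp (w i))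
      ≤ ∑ i, p i * w i + Real.exp M * ∑ i, p i * (w i - ∑ l, p l * w l) ^ 2 := by
  set m := ∑ l, p l * w l with hm
  have hZ : ∑ i, p i * Real.exp (w i) = Real.exp m * ∑ i, p i * Real.exp (w i - m) := by
    rw [mul_sum]
    refine sum_congr rfl fun i _ => ?_
    rw [Real.exp_sub]
    field_simp
  have hpos := sum_mul_exp_pos hp hp1 (fun i => w i - m)
  rw [hZ, Real.log_mul (Real.exp_pos _).ne' hpos.ne', Real.log_exp]
  have h1 := Real.log_le_sub_one_of_pos hpos
  have h2 : ∑ i, p i * Real.exp (w i - m)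
      ≤ ∑ i, (p i + (p i * w i - p i * m) + Real.exp M * (p i * (w i - m) ^ 2)) := by
    refine sum_le_sum fun i _ => ?_
    nlinarith [mul_le_mul_of_nonneg_left (Real.exp_sub_one_sub_id_le_sq_mul_exp (hM i)) (hp i).le]
  rw [sum_add_distrib, sum_add_distrib, sum_sub_distrib, ← sum_mul, ← mul_sum, hp1, ← hm] at h2
  linarith

theorem liftMap_sub_const (p w : Fin c → ℝ) (m : ℝ) :
    liftMap p (fun j => w j - m) = liftMap p w := by
  funext j
  simp only [liftMap, Real.exp_sub, mul_div_assoc', ← sum_div]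
  rw [div_div_div_cancel_right₀ (Real.exp_pos m).ne']

theorem liftMap_le {p w : Fin c → ℝ} (hp : ∀ i, 0 < p i) (hp1 : ∑ i, p i = 1) (j : Fin c) :
    liftMap p w j ≤ p j * Real.exp (w j - ∑ i, p i * w i) := by
  rw [liftMap, Real.exp_sub, mul_div_assoc]
  refine mul_le_mul_of_nonneg_left ?_ (hp j).le
  exact div_le_div_of_nonneg_left (Real.exp_pos _).le (Real.exp_pos _)
    (exp_sum_le_sum_mul_exp hp hp1 w)

theorem sum_mul_log_div_liftMap {p q w : Fin c → ℝ} (hp : ∀ i, 0 < p i) (hp1 : ∑ i, p i = 1)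
    (hq1 : ∑ i, q i = 1) :
    ∑ j, q j * Real.log (q j / liftMap p w j)
      = ∑ j, q j * Real.log (q j / p j) - ∑ j, q j * w j
        + Real.log (∑ i, p i * Real.exp (w i)) := by
  have hZ := sum_mul_exp_pos hp hp1 w
  have h (j) : q j * Real.log (q j / liftMap p w j) = q j * Real.log (q j / p j) - q j * w j
      + q j * Real.log (∑ i, p i * Real.exp (w i)) := by
    rcases eq_or_ne (q j) 0 with h0 | h0
    · simp [h0]
    have := (hp j).ne'
    have := (Real.exp_pos (w j)).ne'
    rw [liftMap, Real.log_div h0 (by positivity), Real.log_div h0 (by positivity),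
      Real.log_div (by positivity) hZ.ne', Real.log_mul (by positivity) (by positivity),
      Real.log_exp]
    ring
  simp only [h]
  rw [sum_add_distrib, sum_sub_distrib, ← sum_mul, hq1, one_mul]

/-- One step of the lifting map with velocity `a + b`, where `b` is a small perturbation. -/
theorem sum_mul_log_div_liftMap_le {p q a b : Fin c → ℝ} (hp : ∀ i, 0 < p i)
    (hp1 : ∑ i, p i = 1) (hq : ∀ i, 0 ≤ q i) (hq1 : ∑ i, q i = 1) {M ε : ℝ}
    (hM : ∀ i, |a i - ∑ l, p l * a l| ≤ M) (hb : ∀ i, |b i| ≤ ε) :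
    ∑ j, q j * Real.log (q j / liftMap p (fun j => a j + b j) j)
      ≤ ∑ j, q j * Real.log (q j / p j) + (∑ j, p j * a j - ∑ j, q j * a j)
        + Real.exp M * ∑ i, p i * (a i - ∑ l, p l * a l) ^ 2 + 2 * ε := by
  rw [sum_mul_log_div_liftMap hp hp1 hq1]
  have hZ : Real.log (∑ i, p i * Real.exp (a i + b i))
      ≤ Real.log (∑ i, p i * Real.exp (a i)) + ε := by
    conv_rhs => rw [← Real.log_exp ε]
    rw [← Real.log_mul (sum_mul_exp_pos hp hp1 a).ne' (Real.exp_pos _).ne']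
    refine Real.log_le_log (sum_mul_exp_pos hp hp1 _) ?_
    rw [sum_mul]
    refine sum_le_sum fun i _ => ?_
    rw [mul_assoc, ← Real.exp_add]
    exact mul_le_mul_of_nonneg_left
      (Real.exp_le_exp.2 (by linarith [le_abs_self (b i), hb i])) (hp i).le
  have hqb : -ε ≤ ∑ j, q j * b j := by
    have : ∑ j, q j * (-ε) ≤ ∑ j, q j * b j := sum_le_sum fun i _ =>
      mul_le_mul_of_nonneg_left (by linarith [neg_abs_le (b i), hb i]) (hq i)
    rwa [← sum_mul, hq1, one_mul] at this
  have h2 := log_sum_mul_exp_le hp hp1 hM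
  simp only [mul_add, sum_add_distrib]
  linarith

theorem sq_sub_sqrt_le_mul_log {p q : ℝ} (hp : 0 ≤ p) (hq : 0 < q) :
    (√p - √q) ^ 2 ≤ p * Real.log (p / q) - p + q := by
  have hsq := Real.sq_sqrt hq.le
  rcases hp.eq_or_lt with rfl | hp
  · simp [hsq]
  have hsp := Real.sq_sqrt hp.le
  have h1 := Real.log_le_sub_one_of_pos (div_pos (Real.sqrt_pos.2 hq) (Real.sqrt_pos.2 hp))
  rw [Real.log_div (Real.sqrt_pos.2 hq).ne' (Real.sqrt_pos.2 hp).ne', Real.log_sqrt hq.le,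
    Real.log_sqrt hp.le] at h1
  rw [Real.log_div hp.ne' hq.ne']
  have h2 := mul_le_mul_of_nonneg_left h1 hp.le
  have h3 : p * (√q / √p) = √p * √q := by
    have := (Real.sqrt_pos.2 hp).ne'
    field_simp
    rw [hsp]
  nlinarith

theorem sum_sq_sub_le_four_mul_dKL {T S : V → Fin c → ℝ}
    (hT : ∀ x, (∀ j, 0 ≤ T x j) ∧ ∑ j, T x j = 1) (hS : ∀ x, (∀ j, 0 < S x j) ∧ ∑ j, S x j = 1) :
    ∑ x, ∑ j, (T x j - S x j) ^ 2 ≤ 4 * dKL T S := by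
  rw [dKL, mul_sum]
  refine sum_le_sum fun x _ => ?_
  have h1 : ∑ j, T x j * Real.log (T x j / S x j)
      = ∑ j, (T x j * Real.log (T x j / S x j) - T x j + S x j) := by
    rw [sum_add_distrib, sum_sub_distrib, (hT x).2, (hS x).2]
    ring
  rw [h1, mul_sum]
  refine sum_le_sum fun j _ => ?_
  have hle {f : Fin c → ℝ} (hf : ∀ j, 0 ≤ f j) (h1 : ∑ j, f j = 1) : √(f j) ≤ 1 := by
    rw [Real.sqrt_le_one, ← h1]
    exact single_le_sum (fun i _ => hf i) (mem_univ j)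
  have hT1 := hle (hT x).1 (hT x).2
  have hS1 := hle (fun i => ((hS x).1 i).le) (hS x).2
  have h2 := sq_sub_sqrt_le_mul_log ((hT x).1 j) ((hS x).1 j)
  have h3 : T x j - S x j = (√(T x j) - √(S x j)) * (√(T x j) + √(S x j)) := by
    nlinarith [Real.sq_sqrt ((hT x).1 j), Real.sq_sqrt ((hS x).1 j).le]
  have h4 : (√(T x j) + √(S x j)) ^ 2 ≤ 4 := by
    nlinarith [Real.sqrt_nonneg (T x j), Real.sqrt_nonneg (S x j)]
  rw [h3, mul_pow]
  nlinarith [mul_le_mul_of_nonneg_left h4 (sq_nonneg (√(T x j) - √(S x j)))]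

/-- A sequence that is quasi-decreasing up to summable errors while it is small, and that gets
arbitrarily small infinitely often, is eventually arbitrarily small. -/
theorem eventually_lt_of_frequently_lt {F e : ℕ → ℝ} (he : ∀ k, 0 ≤ e k) (hs : Summable e)
    {r : ℝ} (hr : 0 < r) (hF : ∀ᶠ k in atTop, F k < r → F (k + 1) ≤ F k + e k)
    (hfr : ∀ s > 0, ∃ᶠ k in atTop, F k < s) {s : ℝ} (hs0 : 0 < s) : ∀ᶠ k in atTop, F k < s := by
  obtain ⟨K, hK⟩ := eventually_atTop.1 hF
  have hm : 0 < min s r := lt_min hs0 hr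
  have htail : ∀ᶠ k in atTop, ∑' i, e (i + k) < min s r / 2 :=
    (tendsto_sum_nat_add e).eventually_lt_const (by positivity)
  obtain ⟨k₀, hk₀, ht, hKk⟩ :=
    ((hfr _ (half_pos hm)).and_eventually (htail.and (eventually_ge_atTop K))).exists
  have hT (k) : ∑' i, e (i + k) = e k + ∑' i, e (i + (k + 1)) := by
    rw [((summable_nat_add_iff k).2 hs).tsum_eq_zero_add, zero_add]
    simp only [add_assoc, add_comm 1 k]
  have key (m) : F (k₀ + m) + ∑' i, e (i + (k₀ + m)) < min s r := by
    induction m with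
    | zero => rw [add_zero]; linarith
    | succ m ih =>
      have h0 : 0 ≤ ∑' i, e (i + (k₀ + m)) := tsum_nonneg fun i => he _
      have h1 := hK (k₀ + m) (by omega) (by linarith [min_le_right s r])
      have h2 := hT (k₀ + m)
      rw [← add_assoc]
      linarith
  refine eventually_atTop.2 ⟨k₀, fun k hk => ?_⟩
  obtain ⟨m, rfl⟩ := Nat.exists_eq_add_of_le hk
  have h0 : 0 ≤ ∑' i, e (i + (k₀ + m)) := tsum_nonneg fun i => he _
  linarith [key m, min_le_left s r]

theorem repl_eq (p u : Fin c → ℝ) (j : Fin c) :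
    repl p u j = p j * (u j - ∑ i, p i * u i) := by
  rw [repl]; ring

theorem repl_sub_const {p : Fin c → ℝ} (hp1 : ∑ i, p i = 1) (u : Fin c → ℝ) (m : ℝ) (j : Fin c) :
    repl p (fun i => u i - m) j = repl p u j := by
  simp only [repl, mul_sub, sum_sub_distrib, ← sum_mul, hp1]
  ring

theorem sum_repl {p : Fin c → ℝ} (hp1 : ∑ i, p i = 1) (u : Fin c → ℝ) : ∑ j, repl p u j = 0 := by
  simp only [repl, sum_sub_distrib, ← mul_sum, hp1]
  ring

theorem frIP_repl {S : V → Fin c → ℝ} (hS : ∀ x, (∀ j, 0 < S x j) ∧ ∑ j, S x j = 1)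
    (u w : V → Fin c → ℝ) :
    frIP S (fun x => repl (S x) (u x)) (fun x => repl (S x) (w x))
      = ∑ x, ∑ j, repl (S x) (u x) j * w x j := by
  refine sum_congr rfl fun x _ => ?_
  have hj (j) : repl (S x) (u x) j * repl (S x) (w x) j / S x j
      = repl (S x) (u x) j * w x j - repl (S x) (u x) j * ∑ i, S x i * w x i := by
    have := ((hS x).1 j).ne'
    rw [repl_eq (S x) (w x)]
    field_simp
  simp only [hj]
  rw [sum_sub_distrib, ← sum_mul, sum_repl (hS x).2]
  ring

theorem frIP_gradJ_dDir {S : V → Fin c → ℝ} (hS : ∀ x, (∀ j, 0 < S x j) ∧ ∑ j, S x j = 1)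
    (Ω : V → V → ℝ) (h : ℝ) :
    frIP S (gradJ Ω S) (fun x => repl (S x) (dDir Ω S h x))
      = -(frIP S (RSOm Ω S) (RSOm Ω S)
          + h / 2 * ∑ x, ∑ j, RSOm Ω S x j * omApp Ω (RSOm Ω S) x j) := by
  have h1 : frIP S (gradJ Ω S) (fun x => repl (S x) (dDir Ω S h x))
      = -frIP S (fun x => repl (S x) (omApp Ω S x)) (fun x => repl (S x)
          (fun i => omApp Ω S x i + h / 2 * omApp Ω (RSOm Ω S) x i)) := by
    simp only [frIP, ← sum_neg_distrib]
    refine sum_congr rfl fun x _ => sum_congr rfl fun j _ => ?_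
    have : dDir Ω S h x = fun j => (fun i => omApp Ω S x i + h / 2 * omApp Ω (RSOm Ω S) x i) j
        - (∑ i, (omApp Ω S x i + h / 2 * omApp Ω (RSOm Ω S) x i)) / (c : ℝ) := rfl
    rw [this, repl_sub_const (hS x).2, gradJ]
    ring
  have h2 : frIP S (RSOm Ω S) (RSOm Ω S) = ∑ x, ∑ j, RSOm Ω S x j * omApp Ω S x j :=
    frIP_repl hS (omApp Ω S) (omApp Ω S)
  rw [h1, frIP_repl hS, h2, mul_sum, ← sum_add_distrib]
  congr 1
  refine sum_congr rfl fun x _ => ?_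
  rw [mul_sum, ← sum_add_distrib]
  refine sum_congr rfl fun j _ => ?_
  simp only [RSOm]
  ring

theorem frIP_RSOm_self {S : V → Fin c → ℝ} (hS : ∀ x j, 0 < S x j) (Ω : V → V → ℝ) :
    frIP S (RSOm Ω S) (RSOm Ω S)
      = ∑ x, ∑ j, S x j * (omApp Ω S x j - ∑ i, S x i * omApp Ω S x i) ^ 2 := by
  refine sum_congr rfl fun x _ => sum_congr rfl fun j _ => ?_
  have := (hS x j).ne'
  rw [RSOm, repl_eq]
  field_simp

theorem sum_sum_mul_omApp_comm {Ω : V → V → ℝ} (hsymm : ∀ x y, Ω x y = Ω y x)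
    (S T : V → Fin c → ℝ) :
    ∑ x, ∑ j, T x j * omApp Ω S x j = ∑ x, ∑ j, S x j * omApp Ω T x j := by
  simp only [omApp, mul_sum]
  rw [sum_comm]
  conv_rhs => rw [sum_comm]
  refine sum_congr rfl fun j _ => ?_
  rw [sum_comm]
  refine sum_congr rfl fun y _ => sum_congr rfl fun x _ => ?_
  rw [hsymm]
  ring

theorem abs_omApp_le {Ω : V → V → ℝ} (hnn : ∀ x y, 0 ≤ Ω x y) (hub : ∀ x y, Ω x y ≤ 1)
    {U : V → Fin c → ℝ} {B : ℝ} (hU : ∀ x j, |U x j| ≤ B) (x : V) (j : Fin c) :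
    |omApp Ω U x j| ≤ Fintype.card V * B := by
  rw [omApp]
  refine (abs_sum_le_sum_abs _ _).trans ?_
  have : ∑ y, |Ω x y * U y j| ≤ ∑ _y : V, B := sum_le_sum fun y _ => by
    rw [abs_mul, abs_of_nonneg (hnn x y)]
    nlinarith [abs_nonneg (U y j), hU y j, hub x y, hnn x y]
  simpa using this

theorem omApp_mem_Icc {Ω : V → V → ℝ} (hnn : ∀ x y, 0 ≤ Ω x y) (hub : ∀ x y, Ω x y ≤ 1)
    {S : V → Fin c → ℝ} (hS : ∀ x j, S x j ∈ Set.Icc (0 : ℝ) 1) (x : V) (j : Fin c) :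
    omApp Ω S x j ∈ Set.Icc (0 : ℝ) (Fintype.card V) := by
  refine ⟨sum_nonneg fun y _ => mul_nonneg (hnn x y) (hS y j).1, ?_⟩
  have := abs_omApp_le (Ω := Ω) hnn hub (U := S) (B := 1)
    (fun x j => by rw [abs_of_nonneg (hS x j).1]; exact (hS x j).2) x j
  simpa using (le_abs_self _).trans this

theorem abs_sub_weighted_sum_le {ι : Type*} [Fintype ι] {p u : ι → ℝ} (hp : ∀ i, 0 ≤ p i)
    (hp1 : ∑ i, p i = 1) {N : ℝ} (hu : ∀ i, u i ∈ Set.Icc 0 N) (j : ι) :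
    |u j - ∑ i, p i * u i| ≤ N := by
  have h0 : 0 ≤ ∑ i, p i * u i := sum_nonneg fun i _ => mul_nonneg (hp i) (hu i).1
  have h1 : ∑ i, p i * u i ≤ N := by
    have : ∑ i, p i * u i ≤ ∑ i, p i * N :=
      sum_le_sum fun i _ => mul_le_mul_of_nonneg_left (hu i).2 (hp i)
    rwa [← sum_mul, hp1, one_mul] at this
  rw [abs_le]
  constructor <;> linarith [(hu j).1, (hu j).2]

theorem mem_Icc_of_mem_simplex {ι : Type*} {S : ι → Fin c → ℝ}
    (hS : ∀ x, (∀ j, 0 ≤ S x j) ∧ ∑ j, S x j = 1) (x : ι) (j : Fin c) :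
    S x j ∈ Set.Icc (0 : ℝ) 1 :=
  ⟨(hS x).1 j, (hS x).2 ▸ single_le_sum (fun i _ => (hS x).1 i) (mem_univ j)⟩

theorem abs_omApp_RSOm_le {Ω : V → V → ℝ} (hnn : ∀ x y, 0 ≤ Ω x y) (hub : ∀ x y, Ω x y ≤ 1)
    {S : V → Fin c → ℝ} (hS : ∀ x, (∀ j, 0 ≤ S x j) ∧ ∑ j, S x j = 1) (x : V) (j : Fin c) :
    |omApp Ω (RSOm Ω S) x j| ≤ (Fintype.card V : ℝ) ^ 2 := by
  rw [sq]
  refine abs_omApp_le hnn hub (fun x j => ?_) x j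
  have hI := mem_Icc_of_mem_simplex hS
  rw [RSOm, repl_eq, abs_mul, abs_of_nonneg (hI x j).1]
  have := abs_sub_weighted_sum_le (hS x).1 (hS x).2 (omApp_mem_Icc hnn hub hI x) j
  exact (mul_le_of_le_one_left (abs_nonneg _) (hI x j).2).trans this

@[fun_prop]
theorem continuous_omApp (Ω : V → V → ℝ) (x : V) (j : Fin c) :
    Continuous fun S : V → Fin c → ℝ => omApp Ω S x j := by
  unfold omApp
  fun_prop

/-- The step `exp_S(θ d(S,h))`, without the irrelevant projection. -/
theorem liftMap_dDir (Ω : V → V → ℝ) (S : V → Fin c → ℝ) (p : Fin c → ℝ) (θ h : ℝ) (x : V) :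
    liftMap p (fun j => θ * dDir Ω S h x j)
      = liftMap p (fun j => θ * omApp Ω S x j + θ * (h / 2) * omApp Ω (RSOm Ω S) x j) := by
  rw [← liftMap_sub_const p (fun j => θ * omApp Ω S x j + θ * (h / 2) * omApp Ω (RSOm Ω S) x j)
    (θ * ((∑ i, (omApp Ω S x i + h / 2 * omApp Ω (RSOm Ω S) x i)) / (c : ℝ)))]
  congr 1
  funext j
  simp only [dDir, proj0]
  ring

/-- Excess of the mean payoff at `T` over the payoff of the pure strategy `j`. -/
def payoffGap (Ω : V → V → ℝ) (T : V → Fin c → ℝ) (x : V) (j : Fin c) : ℝ :=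
  ∑ i, T x i * omApp Ω T x i - omApp Ω T x j

@[fun_prop]
theorem continuous_payoffGap (Ω : V → V → ℝ) (x : V) (j : Fin c) :
    Continuous fun S : V → Fin c → ℝ => payoffGap Ω S x j := by
  unfold payoffGap
  fun_prop

theorem sum_mul_omApp_sub_le {Ω : V → V → ℝ} (hsymm : ∀ x y, Ω x y = Ω y x)
    {S T : V → Fin c → ℝ} (hS : ∀ x, (∀ j, 0 ≤ S x j) ∧ ∑ j, S x j = 1)
    (hJ : Jpot Ω T ≤ Jpot Ω S) :
    ∑ x, ∑ j, S x j * omApp Ω S x j - ∑ x, ∑ j, T x j * omApp Ω S x j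
      ≤ ∑ x, ∑ j, S x j * max (payoffGap Ω T x j) 0 := by
  have h1 : ∑ x, ∑ j, S x j * payoffGap Ω T x j
      = ∑ x, ∑ j, T x j * omApp Ω T x j - ∑ x, ∑ j, S x j * omApp Ω T x j := by
    rw [← sum_sub_distrib]
    refine sum_congr rfl fun x _ => ?_
    simp only [payoffGap, mul_sub, sum_sub_distrib, ← sum_mul, (hS x).2, one_mul]
  have h2 : ∑ x, ∑ j, S x j * payoffGap Ω T x j ≤ ∑ x, ∑ j, S x j * max (payoffGap Ω T x j) 0 :=
    sum_le_sum fun x _ => sum_le_sum fun j _ =>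
      mul_le_mul_of_nonneg_left (le_max_left _ _) ((hS x).1 j)
  rw [sum_sum_mul_omApp_comm hsymm S T]
  simp only [Jpot] at hJ
  linarith

/-- Change of the Kullback–Leibler divergence to a point of lower potential in one step. -/
theorem dKL_liftMap_le {Ω : V → V → ℝ} (hsymm : ∀ x y, Ω x y = Ω y x)
    (hnn : ∀ x y, 0 ≤ Ω x y) (hub : ∀ x y, Ω x y ≤ 1) {S T : V → Fin c → ℝ}
    (hS : ∀ x, (∀ j, 0 < S x j) ∧ ∑ j, S x j = 1) (hT : ∀ x, (∀ j, 0 ≤ T x j) ∧ ∑ j, T x j = 1)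
    (hJ : Jpot Ω T ≤ Jpot Ω S) {θ θmax h : ℝ} (hθ : 0 ≤ θ) (hθm : θ ≤ θmax) (hh : 0 ≤ h) :
    dKL T (fun x => liftMap (S x) (fun j => θ * dDir Ω S h x j))
      ≤ dKL T S + θmax * ∑ x, ∑ j, S x j * max (payoffGap Ω T x j) 0
        + (Real.exp (θmax * Fintype.card V) * θmax ^ 2 * frIP S (RSOm Ω S) (RSOm Ω S)
          + θmax * Fintype.card V ^ 3 * h) := by
  set N : ℝ := (Fintype.card V : ℝ) with hN
  have hS0 : ∀ x, (∀ j, 0 ≤ S x j) ∧ ∑ j, S x j = 1 := fun x => ⟨fun j => ((hS x).1 j).le, (hS x).2⟩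
  have hrow (x) := sum_mul_log_div_liftMap_le (p := S x) (q := T x)
    (a := fun j => θ * omApp Ω S x j)
    (b := fun j => θ * (h / 2) * omApp Ω (RSOm Ω S) x j) (hS x).1 (hS x).2 (hT x).1 (hT x).2
    (M := θmax * N) (ε := θmax * (h / 2) * N ^ 2)
    (fun i => by
      simp only [mul_left_comm _ θ, ← mul_sum, ← mul_sub]
      rw [abs_mul, abs_of_nonneg hθ]
      exact mul_le_mul hθm (abs_sub_weighted_sum_le (hS0 x).1 (hS0 x).2
        (omApp_mem_Icc hnn hub (mem_Icc_of_mem_simplex hS0) x) i) (abs_nonneg _) (hθ.trans hθm))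
    (fun i => by
      rw [abs_mul, abs_of_nonneg (by positivity : 0 ≤ θ * (h / 2))]
      exact mul_le_mul (mul_le_mul_of_nonneg_right hθm (by positivity))
        (abs_omApp_RSOm_le hnn hub hS0 x i) (abs_nonneg _) (by have := hθ.trans hθm; positivity))
  have hrow2 (x) : ∑ j, T x j * Real.log (T x j / liftMap (S x) (fun j => θ * dDir Ω S h x j) j)
      ≤ ∑ j, T x j * Real.log (T x j / S x j)
        + θ * (∑ j, S x j * omApp Ω S x j - ∑ j, T x j * omApp Ω S x j)
        + Real.exp (θmax * N) * θ ^ 2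
          * (∑ j, S x j * (omApp Ω S x j - ∑ i, S x i * omApp Ω S x i) ^ 2)
        + θmax * h * N ^ 2 := by
    rw [liftMap_dDir]
    refine (hrow x).trans (le_of_eq ?_)
    simp only [mul_left_comm _ θ, ← mul_sum, ← mul_sub, mul_pow, mul_left_comm _ (θ ^ 2)]
    ring
  have hsum := sum_le_sum fun x (_ : x ∈ univ) => hrow2 x
  rw [sum_add_distrib, sum_add_distrib, sum_add_distrib, ← mul_sum, ← mul_sum, sum_sub_distrib,
    ← frIP_RSOm_self (fun x => (hS x).1), sum_const, card_univ, nsmul_eq_mul, ← hN] at hsum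
  have hE : 0 ≤ frIP S (RSOm Ω S) (RSOm Ω S) := by
    rw [frIP_RSOm_self (fun x => (hS x).1)]
    exact sum_nonneg fun x _ => sum_nonneg fun j _ => mul_nonneg ((hS0 x).1 j) (sq_nonneg _)
  have hP : 0 ≤ ∑ x, ∑ j, S x j * max (payoffGap Ω T x j) 0 :=
    sum_nonneg fun x _ => sum_nonneg fun j _ => mul_nonneg ((hS0 x).1 j) (le_max_right _ _)
  have h1 := (mul_le_mul_of_nonneg_left (sum_mul_omApp_sub_le hsymm hS0 hJ) hθ).trans
    (mul_le_mul_of_nonneg_right hθm hP)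
  have h2 : Real.exp (θmax * N) * θ ^ 2 * frIP S (RSOm Ω S) (RSOm Ω S)
      ≤ Real.exp (θmax * N) * θmax ^ 2 * frIP S (RSOm Ω S) (RSOm Ω S) := by gcongr
  simp only [dKL] at hsum ⊢
  nlinarith

/-- Strategies whose payoff is worse than average at `T` contract near `T`. -/
theorem sum_liftMap_mul_max_payoffGap_le {Ω : V → V → ℝ}
    (hnn : ∀ x y, 0 ≤ Ω x y) (hub : ∀ x y, Ω x y ≤ 1) {S T : V → Fin c → ℝ}
    (hS : ∀ x, (∀ j, 0 < S x j) ∧ ∑ j, S x j = 1) {θ θmin h δ : ℝ}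
    (hθmin : 0 < θmin) (hθ : θmin ≤ θ) (hh : 0 ≤ h)
    (hδ : ∀ x j, 0 < payoffGap Ω T x j → δ ≤ payoffGap Ω S x j)
    (hhδ : Fintype.card V ^ 2 * h ≤ δ / 2) :
    ∑ x, ∑ j, liftMap (S x) (fun j => θ * dDir Ω S h x j) j * max (payoffGap Ω T x j) 0
      ≤ Real.exp (-(θmin * (δ / 2))) * ∑ x, ∑ j, S x j * max (payoffGap Ω T x j) 0 := by
  have hS0 : ∀ x, (∀ j, 0 ≤ S x j) ∧ ∑ j, S x j = 1 := fun x => ⟨fun j => ((hS x).1 j).le, (hS x).2⟩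
  simp only [mul_sum]
  refine sum_le_sum fun x _ => sum_le_sum fun j _ => ?_
  rcases le_or_gt (payoffGap Ω T x j) 0 with hg | hg
  · simp [max_eq_right hg]
  rw [← mul_assoc]
  refine mul_le_mul_of_nonneg_right ?_ (le_max_right _ _)
  rw [liftMap_dDir, mul_comm (Real.exp _)]
  refine (liftMap_le (hS x).1 (hS x).2 j).trans
    (mul_le_mul_of_nonneg_left (Real.exp_le_exp.2 ?_) ((hS0 x).1 j))
  have hb := abs_omApp_RSOm_le hnn hub hS0 x
  have h1 : -(Fintype.card V : ℝ) ^ 2 ≤ ∑ i, S x i * omApp Ω (RSOm Ω S) x i := by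
    have : ∑ i, S x i * -(Fintype.card V : ℝ) ^ 2 ≤ ∑ i, S x i * omApp Ω (RSOm Ω S) x i :=
      sum_le_sum fun i _ => mul_le_mul_of_nonneg_left (abs_le.1 (hb i)).1 ((hS0 x).1 i)
    rwa [← sum_mul, (hS x).2, one_mul] at this
  have h2 := hδ x j hg
  have h3 : θ * omApp Ω S x j + θ * (h / 2) * omApp Ω (RSOm Ω S) x j
      - ∑ i, S x i * (θ * omApp Ω S x i + θ * (h / 2) * omApp Ω (RSOm Ω S) x i)
      = -(θ * (payoffGap Ω S x j - h / 2 * (omApp Ω (RSOm Ω S) x j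
        - ∑ i, S x i * omApp Ω (RSOm Ω S) x i))) := by
    have hw : ∑ i, S x i * (θ * omApp Ω S x i + θ * (h / 2) * omApp Ω (RSOm Ω S) x i)
        = θ * ∑ i, S x i * omApp Ω S x i
          + θ * (h / 2) * ∑ i, S x i * omApp Ω (RSOm Ω S) x i := by
      rw [mul_sum, mul_sum, ← sum_add_distrib]
      exact sum_congr rfl fun i _ => by ring
    rw [hw, payoffGap]
    ring
  have h4 : h / 2 * (omApp Ω (RSOm Ω S) x j - ∑ i, S x i * omApp Ω (RSOm Ω S) x i)
      ≤ h / 2 * (2 * (Fintype.card V : ℝ) ^ 2) :=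
    mul_le_mul_of_nonneg_left (by linarith [(abs_le.1 (hb j)).2]) (by positivity)
  have hδ0 : 0 ≤ δ / 2 := le_trans (by positivity) hhδ
  rw [h3, neg_le_neg_iff]
  exact mul_le_mul hθ (by linarith) hδ0 (hθmin.le.trans hθ)

theorem tendsto_dKL_self {ι : Type*} {l : Filter ι} {S : ι → V → Fin c → ℝ} {T : V → Fin c → ℝ}
    (h : Tendsto S l (𝓝 T)) : Tendsto (fun k => dKL T (S k)) l (𝓝 0) := by
  have h0 : dKL T T = 0 := by
    refine sum_eq_zero fun x _ => sum_eq_zero fun j _ => ?_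
    rcases eq_or_ne (T x j) 0 with h | h <;> simp [h]
  rw [← h0]
  refine tendsto_finsetSum _ fun x _ => tendsto_finsetSum _ fun j _ => ?_
  rcases eq_or_ne (T x j) 0 with hT | hT
  · simpa [hT] using tendsto_const_nhds
  have hxj : Tendsto (fun k => S k x j) l (𝓝 (T x j)) := (h.apply_nhds x).apply_nhds j
  exact ((tendsto_const_nhds.div hxj hT).log (by simp [hT])).const_mul _

theorem statement18 {V : Type*} [Fintype V] {c : ℕ} (hc : 2 ≤ c)
    (Ω : V → V → ℝ) (hsymm : ∀ x y, Ω x y = Ω y x)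
    (hnn : ∀ x y, 0 ≤ Ω x y) (hub : ∀ x y, Ω x y ≤ 1)
    (S : ℕ → V → Fin c → ℝ)
    (hSW : ∀ k x, (∀ j, 0 < S k x j) ∧ ∑ j, S k x j = 1)
    (θ h : ℕ → ℝ)
    (hrec : ∀ k x, S (k + 1) x = liftMap (S k x) (fun j => θ k * dDir Ω (S k) (h k) x j))
    (θmin θmax : ℝ) (hθmin : 0 < θmin) (hθmax : θmin ≤ θmax)
    (hθrange : ∀ k, θ k ∈ Set.Icc θmin θmax)
    (hhpos : ∀ k, 0 < h k)
    (hstep : ∀ k, h k * |∑ x, ∑ j, RSOm Ω (S k) x j * omApp Ω (RSOm Ω (S k)) x j|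
        < frIP (S k) (RSOm Ω (S k)) (RSOm Ω (S k)))
    (hsum : Summable h)
    (c₁ : ℝ) (hc₁ : 0 < c₁ ∧ c₁ < 1)
    (harmijo : ∀ k, Jpot Ω (S (k + 1)) - Jpot Ω (S k)
        ≤ c₁ * θ k *
          frIP (S k) (gradJ Ω (S k)) (fun x => repl (S k x) (dDir Ω (S k) (h k) x)))
    (θstar : ℝ) (hθpos : 0 < θstar)
    (hθ : Filter.Tendsto θ Filter.atTop (nhds θstar))
    (lammin lammax : ℝ)
    (heigmin : ∃ v : V → ℝ, v ≠ 0 ∧ ∀ x, ∑ y, Ω x y * v y = lammin * v x)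
    (hlbmin : ∀ μ : ℝ, (∃ v : V → ℝ, v ≠ 0 ∧ ∀ x, ∑ y, Ω x y * v y = μ * v x) → lammin ≤ μ)
    (heigmax : ∃ v : V → ℝ, v ≠ 0 ∧ ∀ x, ∑ y, Ω x y * v y = lammax * v x)
    (hubmax : ∀ μ : ℝ, (∃ v : V → ℝ, v ≠ 0 ∧ ∀ x, ∑ y, Ω x y * v y = μ * v x) → μ ≤ lammax)
    (hK : ∃ K : ℕ, ∀ k, K ≤ k →
      h k ≤ (2 * θmin * c₁ / (max |lammin| |lammax|) ^ 2)
              * frIP (S k) (gradJ Ω (S k)) (gradJ Ω (S k)) / (Fintype.card V : ℝ)) :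
    ∃ Sstar : V → Fin c → ℝ,
      (∀ x, (∀ j, 0 ≤ Sstar x j) ∧ ∑ j, Sstar x j = 1)
      ∧ (∀ L : V → Fin c → ℝ,
          (∃ φ : ℕ → ℕ, StrictMono φ ∧
            Filter.Tendsto (fun n => S (φ n)) Filter.atTop (nhds L)) ↔ L = Sstar)
      ∧ Filter.Tendsto (fun k => dKL Sstar (S k)) Filter.atTop (nhds 0)
      ∧ (∀ x j, repl (Sstar x) (omApp Ω Sstar x) j = 0) := by
  have hS0 : ∀ k x, (∀ j, 0 ≤ S k x j) ∧ ∑ j, S k x j = 1 :=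
    fun k x => ⟨fun j => ((hSW k x).1 j).le, (hSW k x).2⟩
  set E : ℕ → ℝ := fun k => frIP (S k) (RSOm Ω (S k)) (RSOm Ω (S k)) with hE
  have hE0 (k) : 0 ≤ E k := ((mul_nonneg (hhpos k).le (abs_nonneg _)).trans_lt (hstep k)).le
  have hdec (k) : Jpot Ω (S (k + 1)) + c₁ * θmin / 2 * E k ≤ Jpot Ω (S k) := by
    have h1 := harmijo k
    rw [frIP_gradJ_dDir (hSW k)] at h1
    have h2 : E k / 2 ≤ E k + h k / 2 * ∑ x, ∑ j, RSOm Ω (S k) x j * omApp Ω (RSOm Ω (S k)) x j := by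
      have := hstep k
      have h3 := mul_le_mul_of_nonneg_left (neg_abs_le
        (∑ x, ∑ j, RSOm Ω (S k) x j * omApp Ω (RSOm Ω (S k)) x j)) (hhpos k).le
      simp only [hE]
      linarith
    have h4 : c₁ * θmin * (E k / 2) ≤ c₁ * θ k * (E k + h k / 2 *
        ∑ x, ∑ j, RSOm Ω (S k) x j * omApp Ω (RSOm Ω (S k)) x j) :=
      mul_le_mul (mul_le_mul_of_nonneg_left (hθrange k).1 hc₁.1.le) h2
        (by linarith [hE0 k]) (mul_nonneg hc₁.1.le (hθmin.le.trans (hθrange k).1))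
    simp only [hE] at h4 ⊢
    linarith
  have hC : 0 < c₁ * θmin / 2 := by have := hc₁.1; positivity
  have hanti : Antitone fun k => Jpot Ω (S k) :=
    antitone_nat_of_succ_le fun k => by nlinarith [hdec k, hE0 k]
  -- a limit point
  have hcpt : IsCompact (Set.Icc (0 : V → Fin c → ℝ) 1) := isCompact_Icc
  obtain ⟨T, -, φ, hφ, hlim⟩ := hcpt.tendsto_subseq (x := S) fun k =>
    ⟨fun x j => (mem_Icc_of_mem_simplex (hS0 k) x j).1,
      fun x j => (mem_Icc_of_mem_simplex (hS0 k) x j).2⟩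
  have hxj (x j) : Tendsto (fun n => S (φ n) x j) atTop (𝓝 (T x j)) :=
    (hlim.apply_nhds x).apply_nhds j
  have hT : ∀ x, (∀ j, 0 ≤ T x j) ∧ ∑ j, T x j = 1 := fun x =>
    ⟨fun j => ge_of_tendsto' (hxj x j) fun n => (hS0 _ x).1 j,
      tendsto_nhds_unique (tendsto_finsetSum _ fun j _ => hxj x j) (by simp [(hS0 _ x).2])⟩
  have hJT (k) : Jpot Ω T ≤ Jpot Ω (S k) := by
    have hcont : Continuous (Jpot (c := c) Ω) := by unfold Jpot; fun_prop
    refine le_of_tendsto ((hcont.tendsto T).comp hlim) ?_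
    filter_upwards [hφ.tendsto_atTop.eventually_ge_atTop k] with n hn using hanti hn
  have hEsum : Summable E := by
    refine summable_of_sum_range_le (c := (Jpot Ω (S 0) - Jpot Ω T) / (c₁ * θmin / 2)) hE0
      fun n => ?_
    rw [le_div_iff₀ hC]
    have : (∑ i ∈ range n, E i) * (c₁ * θmin / 2) ≤ Jpot Ω (S 0) - Jpot Ω (S n) := by
      induction n with
      | zero => simp
      | succ n ih => rw [sum_range_succ]; linarith [hdec n]
    linarith [hJT n]
  have hequi (x j) : repl (T x) (omApp Ω T x) j = 0 := by
    have h1 : Tendsto (fun n => repl (S (φ n) x) (omApp Ω (S (φ n)) x) j ^ 2) atTop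
        (𝓝 (repl (T x) (omApp Ω T x) j ^ 2)) := by
      have hcont : Continuous fun U : V → Fin c → ℝ => repl (U x) (omApp Ω U x) j ^ 2 := by
        unfold repl; fun_prop
      exact (hcont.tendsto T).comp hlim
    have h2 := squeeze_zero (fun n => sq_nonneg _) (fun n => ?_)
      (hEsum.tendsto_atTop_zero.comp hφ.tendsto_atTop)
      (f := fun n => repl (S (φ n) x) (omApp Ω (S (φ n)) x) j ^ 2)
    · exact pow_eq_zero_iff two_ne_zero |>.1 (tendsto_nhds_unique h1 h2)
    · have hnn' (y i) : 0 ≤ RSOm Ω (S (φ n)) y i * RSOm Ω (S (φ n)) y i / S (φ n) y i :=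
        div_nonneg (mul_self_nonneg _) ((hS0 _ y).1 i)
      calc repl (S (φ n) x) (omApp Ω (S (φ n)) x) j ^ 2
          ≤ RSOm Ω (S (φ n)) x j * RSOm Ω (S (φ n)) x j / S (φ n) x j := by
            rw [le_div_iff₀ ((hSW _ x).1 j), ← sq]
            exact mul_le_of_le_one_right (sq_nonneg _) (mem_Icc_of_mem_simplex (hS0 _) x j).2
        _ ≤ ∑ i, RSOm Ω (S (φ n)) x i * RSOm Ω (S (φ n)) x i / S (φ n) x i :=
            single_le_sum (fun i _ => hnn' x i) (mem_univ j)
        _ ≤ E (φ n) := single_le_sum (f := fun y => ∑ i, RSOm Ω (S (φ n)) y i *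
            RSOm Ω (S (φ n)) y i / S (φ n) y i)
            (fun y _ => sum_nonneg fun i _ => hnn' y i) (mem_univ x)
  -- the Lyapunov function
  set P : ℕ → ℝ := fun k => ∑ x, ∑ j, S k x j * max (payoffGap Ω T x j) 0 with hP
  have hP0 (k) : 0 ≤ P k :=
    sum_nonneg fun x _ => sum_nonneg fun j _ => mul_nonneg ((hS0 k x).1 j) (le_max_right _ _)
  have hPφ : Tendsto (fun n => P (φ n)) atTop (𝓝 0) := by
    have h0 : ∑ x, ∑ j, T x j * max (payoffGap Ω T x j) 0 = 0 := by
      refine sum_eq_zero fun x _ => sum_eq_zero fun j _ => ?_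
      have := hequi x j
      rw [repl_eq, mul_eq_zero] at this
      rcases this with h | h
      · simp [h]
      · simp [payoffGap, sub_eq_zero.1 h]
    rw [← h0]
    exact tendsto_finsetSum _ fun x _ => tendsto_finsetSum _ fun j _ => (hxj x j).mul_const _
  obtain ⟨δ, hδ, hδ0⟩ : ∃ δ : ℝ, (∀ x j, 0 < payoffGap Ω T x j → δ < payoffGap Ω T x j) ∧ 0 < δ := by
    have : ∀ᶠ δ in 𝓝[>] (0 : ℝ), ∀ x j, 0 < payoffGap Ω T x j → δ < payoffGap Ω T x j := by
      refine eventually_all.2 fun x => eventually_all.2 fun j => ?_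
      rcases le_or_gt (payoffGap Ω T x j) 0 with h | h
      · exact .of_forall fun _ h' => absurd h' h.not_gt
      · filter_upwards [nhdsWithin_le_nhds (eventually_lt_nhds h)] with δ hδ _ using hδ
    exact (this.and self_mem_nhdsWithin).exists
  have hnear : ∀ᶠ U in 𝓝 T, ∀ x j, 0 < payoffGap Ω T x j → δ ≤ payoffGap Ω U x j := by
    refine eventually_all.2 fun x => eventually_all.2 fun j => ?_
    by_cases h : 0 < payoffGap Ω T x j
    · filter_upwards [(continuous_payoffGap Ω x j).continuousAt.eventually_const_lt (hδ x j h)]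
        with U hU _ using hU.le
    · exact .of_forall fun _ h' => absurd h' h
  obtain ⟨ε, hε, hball⟩ := Metric.eventually_nhds_iff.1 hnear
  have hdist (k) {s : ℝ} (hs : 0 < s) (hk : dKL T (S k) < s ^ 2 / 4) : dist (S k) T < s := by
    refine (dist_pi_lt_iff hs).2 fun x => (dist_pi_lt_iff hs).2 fun j => ?_
    have h1 : (T x j - S k x j) ^ 2 ≤ ∑ x, ∑ j, (T x j - S k x j) ^ 2 :=
      (single_le_sum (f := fun j => (T x j - S k x j) ^ 2) (fun i _ => sq_nonneg _)
        (mem_univ j)).trans (single_le_sum (f := fun x => ∑ j, (T x j - S k x j) ^ 2)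
          (fun y _ => sum_nonneg fun i _ => sq_nonneg _) (mem_univ x))
    have h2 := sum_sq_sub_le_four_mul_dKL hT (hSW k)
    rw [dist_comm, Real.dist_eq]
    exact abs_lt_of_sq_lt_sq (by linarith) hs.le
  have hD0 (k) : 0 ≤ dKL T (S k) := by
    have := sum_sq_sub_le_four_mul_dKL hT (hSW k)
    have : 0 ≤ ∑ x, ∑ j, (T x j - S k x j) ^ 2 :=
      sum_nonneg fun y _ => sum_nonneg fun i _ => sq_nonneg _
    linarith
  set ρ := Real.exp (-(θmin * (δ / 2))) with hρ
  have hρ1 : 0 < 1 - ρ := by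
    rw [sub_pos, hρ, Real.exp_lt_one_iff]
    simp only [Left.neg_neg_iff]
    positivity
  have hθm0 : 0 < θmax := hθmin.trans_le hθmax
  set e : ℕ → ℝ := fun k => Real.exp (θmax * Fintype.card V) * θmax ^ 2 * E k
    + θmax * Fintype.card V ^ 3 * h k with he
  have he0 (k) : 0 ≤ e k := by
    have := hE0 k
    have := (hhpos k).le
    simp only [he]
    positivity
  have hesum : Summable e := (hEsum.mul_left _).add (hsum.mul_left _)
  have hS1 (k) : S (k + 1) = fun x => liftMap (S k x) (fun j => θ k * dDir Ω (S k) (h k) x j) :=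
    funext (hrec k)
  set F : ℕ → ℝ := fun k => dKL T (S k) + θmax / (1 - ρ) * P k with hF
  have hDF (k) : dKL T (S k) ≤ F k := le_add_of_nonneg_right (mul_nonneg (by positivity) (hP0 k))
  have hhsmall : ∀ᶠ k in atTop, (Fintype.card V : ℝ) ^ 2 * h k < δ / 2 :=
    (hsum.mul_left ((Fintype.card V : ℝ) ^ 2)).tendsto_atTop_zero.eventually_lt_const
      (by positivity)
  have hFstep : ∀ᶠ k in atTop, F k < ε ^ 2 / 4 → F (k + 1) ≤ F k + e k := by
    filter_upwards [hhsmall] with k hk hFk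
    have h1 := dKL_liftMap_le hsymm hnn hub (hSW k) hT (hJT k)
      (hθmin.le.trans (hθrange k).1) (hθrange k).2 (hhpos k).le
    have h2 := sum_liftMap_mul_max_payoffGap_le hnn hub (T := T) (hSW k) hθmin (hθrange k).1
      (hhpos k).le (hball (hdist k hε ((hDF k).trans_lt hFk))) hk.le
    have h3 : P (k + 1) ≤ ρ * P k := by simpa only [hP, hS1] using h2
    rw [← hS1] at h1
    have h4 : θmax / (1 - ρ) * P (k + 1) ≤ θmax / (1 - ρ) * P k - θmax * P k := by
      refine (mul_le_mul_of_nonneg_left h3 (by positivity)).trans (le_of_eq ?_)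
      field_simp
      ring
    simp only [hF, he]
    linarith
  have hFφ : Tendsto (fun n => F (φ n)) atTop (𝓝 0) := by
    simpa using (tendsto_dKL_self hlim).add (hPφ.const_mul (θmax / (1 - ρ)))
  have hFlt {s : ℝ} (hs : 0 < s) : ∀ᶠ k in atTop, F k < s :=
    eventually_lt_of_frequently_lt he0 hesum (by positivity) hFstep (fun s hs =>
      hφ.tendsto_atTop.frequently (hFφ.eventually_lt_const hs).frequently) hs
  have hconv : Tendsto S atTop (𝓝 T) := Metric.tendsto_nhds.2 fun s hs => by
    filter_upwards [hFlt (by positivity : 0 < s ^ 2 / 4)] with k hk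
    exact hdist k hs ((hDF k).trans_lt hk)
  refine ⟨T, hT, fun L => ⟨?_, ?_⟩, tendsto_dKL_self hconv, hequi⟩
  · rintro ⟨ψ, hψ, hL⟩
    exact tendsto_nhds_unique hL (hconv.comp hψ.tendsto_atTop)
  · rintro rfl
    exact ⟨φ, hφ, hlim⟩
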